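/- For every n ≥ 0 and all real numbers x, y, s, t, p, q: Σ_{π ∈ S_{n+1}} x^{basc(π)} y^{des(π)−plrmin(π)} s^{suc(π)} t^{plrmin(π)} p^{lrmin(π)−1} q^{simsuc(π)} = Σ_{σ ∈ S_n} x^{exc(σ)} y^{drop(σ)} (p·t+q·s)^{fix(σ)} (p+q)^{cyc(σ)−fix(σ)}. -/

import Mathlib

open Finset

namespace SucEuler

/-- One-line notation word of a permutation: `word π i` is the value (in `1..n`)
at position `i ∈ {1,…,n}`, and `0` for positions outside `{1,…,n}`
(this implements the conventions `π(0)=π(n+1)=0`). -/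
def word {n : ℕ} (π : Equiv.Perm (Fin n)) (i : ℕ) : ℕ :=
  if h : 1 ≤ i ∧ i ≤ n then ((π ⟨i - 1, by omega⟩ : Fin n) : ℕ) + 1 else 0

/-- number of descents -/
def des {n : ℕ} (π : Equiv.Perm (Fin n)) : ℕ :=
  ((Finset.Icc 1 (n - 1)).filter fun i => word π (i + 1) < word π i).card

/-- number of ascents -/
def asc {n : ℕ} (π : Equiv.Perm (Fin n)) : ℕ :=
  ((Finset.Icc 1 (n - 1)).filter fun i => word π i < word π (i + 1)).card

/-- number of successions -/
def suc {n : ℕ} (π : Equiv.Perm (Fin n)) : ℕ :=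
  ((Finset.Icc 1 (n - 1)).filter fun i => word π (i + 1) = word π i + 1).card

/-- number of big ascents -/
def basc {n : ℕ} (π : Equiv.Perm (Fin n)) : ℕ :=
  ((Finset.Icc 1 (n - 1)).filter fun i => word π i + 2 ≤ word π (i + 1)).card

/-- number of excedances -/
def excStat {n : ℕ} (σ : Equiv.Perm (Fin n)) : ℕ :=
  (Finset.univ.filter fun i : Fin n => i < σ i).card

/-- number of fixed points -/
def fixStat {n : ℕ} (σ : Equiv.Perm (Fin n)) : ℕ :=
  (Finset.univ.filter fun i : Fin n => σ i = i).card

/-- number of drops -/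
def dropStat {n : ℕ} (σ : Equiv.Perm (Fin n)) : ℕ :=
  (Finset.univ.filter fun i : Fin n => σ i < i).card

/-- number of excedances at positions `i ≥ 2` -/
def excHat {n : ℕ} (σ : Equiv.Perm (Fin n)) : ℕ :=
  (Finset.univ.filter fun i : Fin n => 0 < (i : ℕ) ∧ i < σ i).card

/-- number of fixed points other than `1` -/
def fixHat {n : ℕ} (σ : Equiv.Perm (Fin n)) : ℕ :=
  (Finset.univ.filter fun i : Fin n => 0 < (i : ℕ) ∧ σ i = i).card

/-- number of cycles (orbits) of a permutation -/
def cyc {n : ℕ} (σ : Equiv.Perm (Fin n)) : ℕ :=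
  σ.cycleType.card + fixStat σ

/-- number of cycle double ascents: values `x` with `σ⁻¹(x) < x < σ(x)` -/
def cda {n : ℕ} (σ : Equiv.Perm (Fin n)) : ℕ :=
  (Finset.univ.filter fun x : Fin n => σ⁻¹ x < x ∧ x < σ x).card

open Classical in
/-- number of left-to-right minima -/
noncomputable def lrmin {n : ℕ} (π : Equiv.Perm (Fin n)) : ℕ :=
  ((Finset.Icc 1 n).filter fun i => ∀ j ∈ Finset.Icc 1 n, j < i → word π i < word π j).card

open Classical in
/-- number of proper left-to-right minima -/
noncomputable def plrmin {n : ℕ} (π : Equiv.Perm (Fin n)) : ℕ :=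
  ((Finset.Icc 1 n).filter fun i =>
    (∀ j ∈ Finset.Icc 1 n, j < i → word π i < word π j) ∧ word π i ≠ 1 ∧
      ∃ k ∈ Finset.Icc 1 n, i < k ∧ word π k = word π i - 1 ∧ word π (k + 1) < word π k).card

open Classical in
/-- number of simsun successions -/
noncomputable def simsuc {n : ℕ} (π : Equiv.Perm (Fin n)) : ℕ :=
  ((Finset.Icc 1 n).filter fun i =>
    ∃ j ∈ Finset.Icc 1 n, i < j ∧ word π j = word π i + 1 ∧
      ∀ k ∈ Finset.Icc 1 n, i < k → k < j → word π i + 1 < word π k).card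

/-- number of peaks (with the boundary conventions `π(0)=π(n+1)=0`) -/
def pk {n : ℕ} (π : Equiv.Perm (Fin n)) : ℕ :=
  ((Finset.Icc 1 n).filter fun i => word π (i - 1) < word π i ∧ word π (i + 1) < word π i).card

/-- number of valleys -/
def valStat {n : ℕ} (π : Equiv.Perm (Fin n)) : ℕ :=
  ((Finset.Icc 1 n).filter fun i => word π i < word π (i - 1) ∧ word π i < word π (i + 1)).card

/-- number of double ascents -/
def dasc {n : ℕ} (π : Equiv.Perm (Fin n)) : ℕ :=
  ((Finset.Icc 1 n).filter fun i => word π (i - 1) < word π i ∧ word π i < word π (i + 1)).card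

/-- number of double descents -/
def ddes {n : ℕ} (π : Equiv.Perm (Fin n)) : ℕ :=
  ((Finset.Icc 1 n).filter fun i => word π (i + 1) < word π i ∧ word π i < word π (i - 1)).card

open Classical in
/-- `nextVal σ m x` is the (0-indexed) first value `≤ m` (i.e. `< m` in 0-indexed terms)
in the forward orbit of `x` under `σ`: it equals `σ^t(x)` for the minimal `t ≥ 1`
with `σ^t(x) < m`, when such `t` exists. This is the action of the permutation `σ_k`
(with `m = n - k`) obtained by removing the `k` largest letters from the cycles of `σ`. -/
noncomputable def nextVal {n : ℕ} (σ : Equiv.Perm (Fin n)) (m : ℕ) (x : Fin n) : ℕ :=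
  if h : ∃ t : ℕ, 0 < t ∧ (((σ ^ t) x : Fin n) : ℕ) < m then (((σ ^ Nat.find h) x : Fin n) : ℕ)
  else 0

/-- `σ` is a simsun permutation of the second kind: for every `0 ≤ k ≤ n-1`, the
permutation of `[n-k]` obtained from `σ` by removing the `k` largest letters has
no cycle double ascents. (Here `m = n - k` and values are 0-indexed.) -/
def IsSimsun2 {n : ℕ} (σ : Equiv.Perm (Fin n)) : Prop :=
  ∀ m ≤ n, ∀ x : Fin n, (x : ℕ) < m →
    ¬ (nextVal σ⁻¹ m x < (x : ℕ) ∧ (x : ℕ) < nextVal σ m x)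

noncomputable instance {n : ℕ} : DecidablePred (IsSimsun2 (n := n)) :=
  fun _ => Classical.propDecidable _

/-- the derangement polynomial `d_n(x)` -/
def dpoly (n : ℕ) (x : ℝ) : ℝ :=
  ∑ σ ∈ Finset.univ.filter fun σ : Equiv.Perm (Fin n) => fixStat σ = 0, x ^ excStat σ

/-- the Eulerian polynomial `A_n(x)` -/
def eulerian (n : ℕ) (x : ℝ) : ℝ :=
  ∑ π : Equiv.Perm (Fin n), x ^ des π


/-! ### Abstract words -/

def phi (i k : ℕ) : ℕ := if k ≤ i then k else k + 1

def insw (N : ℕ) (w : ℕ → ℕ) (i k : ℕ) : ℕ :=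
  if k ≤ i then w k else if k = i + 1 then N + 1 else w (k - 1)

structure IsW (N : ℕ) (w : ℕ → ℕ) : Prop where
  pos : ∀ i, 1 ≤ i → i ≤ N → 1 ≤ w i
  le : ∀ i, w i ≤ N
  out : ∀ i, N < i → w i = 0
  inj : ∀ i j, 1 ≤ i → i ≤ N → 1 ≤ j → j ≤ N → w i = w j → i = j
  surj : ∀ v, 1 ≤ v → v ≤ N → ∃ i, 1 ≤ i ∧ i ≤ N ∧ w i = v

lemma insw_phi (N w i k) : insw N w i (phi i k) = w k := by
  unfold insw phi; split_ifs <;> first | rfl | omega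

lemma insw_new (N w i) : insw N w i (i + 1) = N + 1 := by
  unfold insw; split_ifs <;> omega

lemma insw_phi_succ (N w i k) (h : k ≠ i) : insw N w i (phi i k + 1) = w (k + 1) := by
  unfold insw phi; split_ifs <;> first | rfl | omega

lemma phi_cases (i j : ℕ) : j = i + 1 ∨ ∃ k, j = phi i k := by
  rcases lt_trichotomy j (i+1) with h | h | h
  · right; exact ⟨j, by unfold phi; split_ifs <;> omega⟩
  · left; exact h
  · right; exact ⟨j - 1, by unfold phi; split_ifs <;> omega⟩

lemma forall_phi (i : ℕ) (P : ℕ → Prop) : (∀ j, P j) ↔ P (i+1) ∧ ∀ k, P (phi i k) := by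
  constructor
  · intro h; exact ⟨h _, fun k => h _⟩
  · rintro ⟨h1, h2⟩ j
    rcases phi_cases i j with rfl | ⟨k, rfl⟩
    · exact h1
    · exact h2 k

lemma exists_phi (i : ℕ) (P : ℕ → Prop) : (∃ j, P j) ↔ P (i+1) ∨ ∃ k, P (phi i k) := by
  constructor
  · rintro ⟨j, h⟩
    rcases phi_cases i j with rfl | ⟨k, rfl⟩
    · exact Or.inl h
    · exact Or.inr ⟨k, h⟩
  · rintro (h | ⟨k, h⟩)
    · exact ⟨_, h⟩
    · exact ⟨_, h⟩

lemma phi_lt (i a b : ℕ) : phi i a < phi i b ↔ a < b := by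
  unfold phi; split_ifs <;> omega
lemma phi_inj (i a b : ℕ) : phi i a = phi i b ↔ a = b := by
  unfold phi; split_ifs <;> omega
lemma phi_pos (i a : ℕ) : 1 ≤ phi i a ↔ 1 ≤ a := by
  unfold phi; split_ifs <;> omega
lemma phi_le {i N : ℕ} (a : ℕ) (h : i ≤ N) : phi i a ≤ N + 1 ↔ a ≤ N := by
  unfold phi; split_ifs <;> omega
lemma new_lt_phi (i a : ℕ) : i + 1 < phi i a ↔ i < a := by
  unfold phi; split_ifs <;> omega
lemma phi_lt_new (i a : ℕ) : phi i a < i + 1 ↔ a ≤ i := by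
  unfold phi; split_ifs <;> omega

lemma prod_phi (N i : ℕ) (hi : i ≤ N) (f : ℕ → ℝ) :
    ∏ k ∈ Finset.Icc 1 (N+1), f k = f (i+1) * ∏ k ∈ Finset.Icc 1 N, f (phi i k) := by
  have h : Finset.Icc 1 (N+1) = insert (i+1) ((Finset.Icc 1 N).image (phi i)) := by
    ext j
    simp only [Finset.mem_Icc, Finset.mem_insert, Finset.mem_image]
    rcases phi_cases i j with rfl | ⟨k, rfl⟩
    · simp; omega
    · rw [phi_pos, phi_le _ hi]
      constructor
      · intro h; exact Or.inr ⟨k, h, rfl⟩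
      · rintro (h | ⟨a, h, h2⟩)
        · unfold phi at h; split_ifs at h <;> omega
        · rw [phi_inj] at h2; subst h2; exact h
  rw [h, Finset.prod_insert, Finset.prod_image]
  · intro a _ b _ hab; exact (phi_inj i a b).1 hab
  · simp only [Finset.mem_image, not_exists, not_and]
    intro a _ h; unfold phi at h; split_ifs at h <;> omega

def LL (w : ℕ → ℕ) (k : ℕ) : Prop := ∀ j, 1 ≤ j → j < k → w k < w j

def TT (w : ℕ → ℕ) (k : ℕ) : Prop := ∃ a, 1 ≤ a ∧ a < k ∧ LL w a ∧ w a = w k + 1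

def QQ (N : ℕ) (w : ℕ → ℕ) (k : ℕ) : Prop :=
  ∃ j, j ≤ N ∧ k < j ∧ w j = w k + 1 ∧ ∀ l, k < l → l < j → w k + 1 < w l

lemma LL_ins {N w i k} (hw : IsW N w) : LL (insw N w i) (phi i k) ↔ LL w k := by
  unfold LL
  rw [forall_phi i]
  simp only [insw_phi, insw_new, phi_pos, phi_lt]
  have := hw.le k
  constructor
  · intro h; exact h.2
  · intro h; exact ⟨fun _ _ => by omega, h⟩

lemma LL_new {N w i} (hw : IsW N w) : LL (insw N w i) (i+1) ↔ i = 0 := by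
  unfold LL
  rw [forall_phi i]
  simp only [insw_phi, insw_new, phi_pos, phi_lt_new]
  constructor
  · intro h
    by_contra hi
    have := h.2 i (by omega) le_rfl
    have := hw.le i
    omega
  · rintro rfl
    exact ⟨by omega, by intros; omega⟩

lemma TT_ins {N w i k} (hw : IsW N w) :
    TT (insw N w i) (phi i k) ↔ TT w k ∨ (i = 0 ∧ 1 ≤ k ∧ w k = N) := by
  unfold TT
  rw [exists_phi i]
  simp only [insw_phi, insw_new, phi_pos, phi_lt, LL_ins hw, LL_new hw, new_lt_phi]
  constructor
  · rintro (h | h)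
    · right; omega
    · left; exact h
  · rintro (h | h)
    · right; exact h
    · left; omega

lemma not_TT_max {N w k} (hw : IsW N w) (h : w k = N) : ¬ TT w k := by
  rintro ⟨a, _, _, _, h2⟩
  have := hw.le a
  omega

lemma QQ_ins {N w i k} (hw : IsW N w) (hi : i ≤ N) :
    QQ (N+1) (insw N w i) (phi i k) ↔ QQ N w k ∨ (i = k ∧ w k = N) := by
  unfold QQ
  rw [exists_phi i]
  have h1 := hw.le k
  simp only [insw_phi, insw_new, phi_lt, phi_le _ hi, phi_lt_new]
  constructor
  · rintro (⟨_, h, h2, h3⟩ | ⟨j, hj, hkj, hv, h⟩)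
    · right
      refine ⟨?_, by omega⟩
      by_contra hne
      rw [forall_phi i] at h3
      have := h3.2 i
      simp only [insw_phi, phi_lt, phi_lt_new] at this
      have h5 := hw.le i
      have := this (by omega) le_rfl
      omega
    · left
      refine ⟨j, hj, hkj, hv, ?_⟩
      rw [forall_phi i] at h
      simpa only [insw_phi, phi_lt] using h.2
  · rintro (⟨j, hj, hkj, hv, h⟩ | ⟨rfl, h⟩)
    · right
      refine ⟨j, hj, hkj, hv, ?_⟩
      rw [forall_phi i]
      simp only [insw_phi, insw_new, phi_lt]
      refine ⟨?_, h⟩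
      intro _ _
      have := hw.le j
      omega
    · left
      refine ⟨by omega, by omega, by omega, ?_⟩
      intro l hl hl2
      unfold phi at hl
      simp at hl
      omega

lemma not_QQ_max {N w k} (hw : IsW N w) (h : w k = N) : ¬ QQ N w k := by
  rintro ⟨a, _, _, h2, _⟩
  have := hw.le a
  omega

lemma not_QQ_new {N w i} (hw : IsW N w) : ¬ QQ (N+1) (insw N w i) (i+1) := by
  unfold QQ
  rw [exists_phi i]
  simp only [insw_phi, insw_new]
  rintro (h | ⟨k, _, _, h, _⟩)
  · omega
  · have := hw.le k; omega

open Classical in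
noncomputable def tau (x y s t : ℝ) (N : ℕ) (w : ℕ → ℕ) (k : ℕ) : ℝ :=
  if w k = N then 1 else if w k + 2 ≤ w (k+1) then x else if w (k+1) = w k + 1 then s
  else if TT w k then t else y

open Classical in
noncomputable def gam (p q : ℝ) (N : ℕ) (w : ℕ → ℕ) (k : ℕ) : ℝ :=
  (if LL w k ∧ w k ≠ 1 then p else 1) * (if QQ N w k then q else 1)

section
variable {x y s t p q : ℝ} {N : ℕ} {w : ℕ → ℕ} {i k : ℕ}

lemma tau_new (N w i) : tau x y s t (N+1) (insw N w i) (i+1) = 1 := by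
  unfold tau; simp [insw_new]

open Classical in
lemma gam_new (hw : IsW N w) (hN : 1 ≤ N) :
    gam p q (N+1) (insw N w i) (i+1) = if i = 0 then p else 1 := by
  unfold gam
  simp only [insw_new, LL_new hw, not_QQ_new hw, if_false, mul_one]
  congr 1
  simp; omega

open Classical in
lemma tau_same (hw : IsW N w) (hk : w k ≠ N) (hki : k ≠ i) :
    tau x y s t (N+1) (insw N w i) (phi i k) = tau x y s t N w k := by
  unfold tau
  have := hw.le k
  have h1 : ¬ (w k = N + 1) := by omega
  simp only [insw_phi, insw_phi_succ _ _ _ _ hki, TT_ins hw, hk, and_false, or_false, if_neg h1,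
    if_false]

lemma tau_here (hw : IsW N w) (hk : w k ≠ N) :
    tau x y s t (N+1) (insw N w k) (phi k k) = x := by
  unfold tau
  have := hw.le k
  have h1 : ¬ (w k = N + 1) := by omega
  have h2 : phi k k + 1 = k + 1 := by simp [phi]
  have h3 : w k + 2 ≤ N + 1 := by omega
  simp only [insw_phi, h2, insw_new, if_neg h1, if_pos h3]

open Classical in
lemma tau_max (hw : IsW N w) (hk : w k = N) (h1k : 1 ≤ k) :
    tau x y s t (N+1) (insw N w i) (phi i k) = if i = 0 then t else if i = k then s else y := by
  unfold tau
  have h1 : ¬ (w k = N + 1) := by omega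
  by_cases hik : i = k
  · subst hik
    have h2 : phi i i + 1 = i + 1 := by simp [phi]
    have h3 : i ≠ 0 := by omega
    simp only [insw_phi, h2, insw_new, hk]
    simp [h3]
  · have := hw.le (k+1)
    have h3 : ¬ (w k + 2 ≤ w (k+1)) := by omega
    have h4 : ¬ (w (k+1) = w k + 1) := by omega
    simp only [insw_phi, insw_phi_succ _ _ _ _ (Ne.symm hik), TT_ins hw, not_TT_max hw hk, if_neg h1,
      if_neg h3, if_neg h4, if_neg hik]
    simp [hk, h1k]

open Classical in
lemma gam_same (hw : IsW N w) (hi : i ≤ N) (hk : w k ≠ N) :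
    gam p q (N+1) (insw N w i) (phi i k) = gam p q N w k := by
  unfold gam
  simp only [insw_phi, LL_ins hw, QQ_ins hw hi, hk, and_false, or_false]

open Classical in
lemma gam_max (hw : IsW N w) (hi : i ≤ N) (hk : w k = N) :
    gam p q (N+1) (insw N w i) (phi i k) = gam p q N w k * if i = k then q else 1 := by
  unfold gam
  simp only [insw_phi, LL_ins hw, QQ_ins hw hi, not_QQ_max hw hk, if_false, false_or]
  simp [hk]

noncomputable def wt (x y s t p q : ℝ) (N : ℕ) (w : ℕ → ℕ) : ℝ :=
  (∏ k ∈ Finset.Icc 1 N, tau x y s t N w k) * ∏ k ∈ Finset.Icc 1 N, gam p q N w k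

lemma prod_gam_ins (hw : IsW N w) (hN : 1 ≤ N) (hi : i ≤ N) {m : ℕ} (hm1 : 1 ≤ m) (hm2 : m ≤ N)
    (hm : w m = N) : ∏ k ∈ Finset.Icc 1 (N+1), gam p q (N+1) (insw N w i) k =
      (if i = 0 then p else if i = m then q else 1) * ∏ k ∈ Finset.Icc 1 N, gam p q N w k := by
  rw [prod_phi N i hi, gam_new hw hN]
  have hmem : m ∈ Finset.Icc 1 N := by simp; omega
  rw [← Finset.mul_prod_erase _ _ hmem, ← Finset.mul_prod_erase _ _ hmem, gam_max hw hi hm]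
  rw [Finset.prod_congr rfl (g := fun k => gam p q N w k)]
  · split_ifs <;> first | omega | ring
  · intro k hk
    simp only [Finset.mem_erase, Finset.mem_Icc] at hk
    apply gam_same hw hi
    intro h
    exact hk.1 (hw.inj _ _ hk.2.1 hk.2.2 hm1 hm2 (by omega))

lemma tau_maxone {m : ℕ} (hm : w m = N) : tau x y s t N w m = 1 := by
  unfold tau; simp [hm]

lemma prod_tau_ins_special (hw : IsW N w) {m : ℕ} (hm1 : 1 ≤ m) (hm2 : m ≤ N)
    (hm : w m = N) (hi : i = 0 ∨ i = m) : ∏ k ∈ Finset.Icc 1 (N+1), tau x y s t (N+1) (insw N w i) k =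
      (if i = 0 then t else s) * ∏ k ∈ Finset.Icc 1 N, tau x y s t N w k := by
  rw [prod_phi N i (by omega), tau_new]
  have hmem : m ∈ Finset.Icc 1 N := by simp; omega
  rw [← Finset.mul_prod_erase _ _ hmem, ← Finset.mul_prod_erase _ _ hmem, tau_max hw hm hm1,
    tau_maxone hm]
  rw [Finset.prod_congr rfl (g := fun k => tau x y s t N w k)]
  · split_ifs <;> first | omega | ring
  · intro k hk
    simp only [Finset.mem_erase, Finset.mem_Icc] at hk
    apply tau_same hw
    · intro h
      exact hk.1 (hw.inj _ _ hk.2.1 hk.2.2 hm1 hm2 (by omega))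
    · omega

lemma prod_tau_ins (hw : IsW N w) {m : ℕ} (hm1 : 1 ≤ m) (hm2 : m ≤ N)
    (hm : w m = N) (hi0 : 1 ≤ i) (hi : i ≤ N) (him : i ≠ m) :
    ∏ k ∈ Finset.Icc 1 (N+1), tau x y s t (N+1) (insw N w i) k =
      x * y * ∏ k ∈ (Finset.Icc 1 N).erase i, tau x y s t N w k := by
  rw [prod_phi N i hi, tau_new]
  have hmem : m ∈ (Finset.Icc 1 N).erase i := by simp; omega
  have hmemi : i ∈ Finset.Icc 1 N := by simp; omega
  rw [← Finset.mul_prod_erase _ _ hmemi, ← Finset.mul_prod_erase _ _ hmem,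
    ← Finset.mul_prod_erase _ _ hmem, tau_max hw hm hm1,
    tau_maxone hm, tau_here hw]
  · rw [Finset.prod_congr rfl (g := fun k => tau x y s t N w k)]
    · split_ifs <;> first | omega | ring
    · intro k hk
      simp only [Finset.mem_erase, Finset.mem_Icc] at hk
      apply tau_same hw
      · intro h
        exact hk.1 (hw.inj _ _ hk.2.2.1 hk.2.2.2 hm1 hm2 (by omega))
      · omega
  · intro h
    exact him (hw.inj _ _ hi0 hi hm1 hm2 (by omega))

lemma tau_deriv (x y s t : ℝ) (N w k) : HasDerivAt (fun h => tau (x+h) (y+h) (s+h) (t+h) N w k)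
    (if w k = N then 0 else 1) 0 := by
  unfold tau
  split_ifs
  · exact hasDerivAt_const _ _
  all_goals exact (hasDerivAt_id _).const_add _

lemma wt_rec (x y s t p q : ℝ) (hw : IsW N w) (hN : 1 ≤ N) :
    ∃ d, HasDerivAt (fun h => wt (x+h) (y+h) (s+h) (t+h) p q N w) d 0 ∧
      ∑ i ∈ Finset.range (N+1), wt x y s t p q (N+1) (insw N w i) =
        (p * t + q * s) * wt x y s t p q N w + x * y * d := by
  obtain ⟨m, hm1, hm2, hm⟩ := hw.surj N hN le_rfl
  have hD := (HasDerivAt.fun_finsetProd (u := Finset.Icc 1 N)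
    (fun k _ => tau_deriv x y s t N w k)).mul_const (∏ k ∈ Finset.Icc 1 N, gam p q N w k)
  refine ⟨_, hD, ?_⟩
  simp only [add_zero]
  rw [Finset.range_eq_Ico, Finset.sum_eq_sum_Ico_succ_bot (by omega)]
  have hI : Finset.Ico (0+1) (N+1) = Finset.Icc 1 N := by ext; simp only [Finset.mem_Ico, Finset.mem_Icc]; omega
  have hmem : m ∈ Finset.Icc 1 N := by simp; omega
  rw [hI, ← Finset.add_sum_erase _ _ hmem, ← Finset.add_sum_erase (Finset.Icc 1 N) (fun i => (∏ j ∈ (Finset.Icc 1 N).erase i, _) • _) hmem]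
  simp only [hm, if_true, smul_zero, zero_add]
  have hm0 : m ≠ 0 := by omega
  unfold wt
  rw [prod_gam_ins hw hN (by omega) hm1 hm2 hm, prod_gam_ins hw hN (by omega) hm1 hm2 hm,
    prod_tau_ins_special hw hm1 hm2 hm (Or.inl rfl), prod_tau_ins_special hw hm1 hm2 hm (Or.inr rfl)]
  simp only [if_true, if_neg hm0]
  rw [Finset.sum_mul, Finset.mul_sum, add_mul, ← add_assoc]
  congr 1
  · ring
  · apply Finset.sum_congr rfl
    intro k hk
    simp only [Finset.mem_erase, Finset.mem_Icc] at hk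
    have hne : w k ≠ N := fun h =>
      hk.1 (hw.inj _ _ hk.2.1 hk.2.2 hm1 hm2 (by omega))
    have h0 : k ≠ 0 := by omega
    rw [prod_gam_ins hw hN (by omega) hm1 hm2 hm, prod_tau_ins hw hm1 hm2 hm hk.2.1 hk.2.2 hk.1]
    simp only [if_neg hne, if_neg h0, if_neg hk.1, smul_eq_mul]
    ring

end

/-! ### Words of permutations -/

lemma word_of {n : ℕ} (π : Equiv.Perm (Fin n)) (k : Fin n) : word π (k + 1) = (π k : ℕ) + 1 := by
  unfold word
  rw [dif_pos (by omega)]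
  simp

lemma isW_word {n : ℕ} (π : Equiv.Perm (Fin n)) : IsW n (word π) where
  pos i h1 h2 := by unfold word; rw [dif_pos ⟨h1, h2⟩]; omega
  le i := by unfold word; split_ifs <;> omega
  out i h := by unfold word; rw [dif_neg (by omega)]
  inj i j h1 h2 h3 h4 h := by
    have e1 := word_of π ⟨i - 1, by omega⟩
    have e2 := word_of π ⟨j - 1, by omega⟩
    simp only [Nat.sub_add_cancel h1] at e1
    simp only [Nat.sub_add_cancel h3] at e2
    have : π ⟨i - 1, by omega⟩ = π ⟨j - 1, by omega⟩ := by
      apply Fin.ext; omega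
    have := π.injective this
    simp at this; omega
  surj v h1 h2 := by
    refine ⟨(π.symm ⟨v - 1, by omega⟩ : ℕ) + 1, by omega, by omega, ?_⟩
    rw [word_of]; simp; omega

def insPerm {N : ℕ} (i : Fin (N+1)) (π : Equiv.Perm (Fin N)) : Equiv.Perm (Fin (N+1)) :=
  ((finSuccEquiv' i).trans (Equiv.optionCongr π)).trans (finSuccEquiv' (Fin.last N)).symm

lemma insPerm_self {N : ℕ} (i : Fin (N+1)) (π : Equiv.Perm (Fin N)) :
    insPerm i π i = Fin.last N := by
  simp [insPerm]

lemma insPerm_succAbove {N : ℕ} (i : Fin (N+1)) (π : Equiv.Perm (Fin N)) (k : Fin N) :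
    insPerm i π (i.succAbove k) = (π k).castSucc := by
  simp [insPerm]

lemma insPerm_bij (N : ℕ) : Function.Bijective
    (fun z : Equiv.Perm (Fin N) × Fin (N+1) => insPerm z.2 z.1) := by
  rw [Fintype.bijective_iff_injective_and_card]
  constructor
  · rintro ⟨π, i⟩ ⟨π', i'⟩ h
    simp only at h
    have hi : i = i' := by
      have h1 := insPerm_self i π
      have h2 := insPerm_self i' π'
      rw [← h2, h] at h1
      exact (insPerm i' π').injective h1
    subst hi
    have : π = π' := by
      ext k
      have := insPerm_succAbove i π k
      rw [h, insPerm_succAbove] at this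
      exact (congrArg Fin.val this).symm
    rw [this]
  · simp [Fintype.card_perm, Nat.factorial_succ, mul_comm]

lemma word_insPerm {N : ℕ} (i : Fin (N+1)) (π : Equiv.Perm (Fin N)) :
    word (insPerm i π) = insw N (word π) i := by
  funext j
  have hi := i.2
  rcases phi_cases i j with rfl | ⟨k, rfl⟩
  · rw [insw_new, word_of, insPerm_self]; simp
  · rw [insw_phi]
    by_cases hk : 1 ≤ k ∧ k ≤ N
    · have e : phi i k = (i.succAbove ⟨k - 1, by omega⟩ : ℕ) + 1 := by
        unfold phi
        by_cases h : k ≤ i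
        · rw [Fin.succAbove_of_castSucc_lt _ _ (by rw [Fin.lt_def]; simp; omega)]
          simp [h]; omega
        · rw [Fin.succAbove_of_le_castSucc _ _ (by rw [Fin.le_def]; simp; omega)]
          simp [h]; omega
      rw [e, word_of, insPerm_succAbove]
      have := word_of π ⟨k - 1, by omega⟩
      simp only [Nat.sub_add_cancel hk.1] at this
      rw [this]; simp
    · have h1 : word π k = 0 := by unfold word; rw [dif_neg hk]
      rw [h1]
      unfold word; rw [dif_neg]
      rw [phi_pos, phi_le _ (by omega)]; exact hk

lemma sum_ins (N : ℕ) (F : (ℕ → ℕ) → ℝ) :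
    ∑ π : Equiv.Perm (Fin (N+1)), F (word π) =
      ∑ π : Equiv.Perm (Fin N), ∑ i ∈ Finset.range (N+1), F (insw N (word π) i) := by
  rw [← (insPerm_bij N).sum_comp (fun π => F (word π)), Fintype.sum_prod_type]
  apply Finset.sum_congr rfl
  intro π _
  rw [Finset.sum_range]
  simp only [word_insPerm]

noncomputable def Lsum (N : ℕ) (x y s t p q : ℝ) : ℝ :=
  ∑ π : Equiv.Perm (Fin N), wt x y s t p q N (word π)

lemma Lsum_rec (N : ℕ) (hN : 1 ≤ N) (x y s t p q : ℝ) :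
    ∃ d, HasDerivAt (fun h => Lsum N (x+h) (y+h) (s+h) (t+h) p q) d 0 ∧
      Lsum (N+1) x y s t p q = (p * t + q * s) * Lsum N x y s t p q + x * y * d := by
  choose d hd1 hd2 using fun π : Equiv.Perm (Fin N) => wt_rec x y s t p q (isW_word π) hN
  refine ⟨∑ π, d π, HasDerivAt.fun_sum fun π _ => hd1 π, ?_⟩
  unfold Lsum
  rw [sum_ins N (fun w => wt x y s t p q (N+1) w)]
  simp only [hd2]
  rw [Finset.sum_add_distrib, Finset.mul_sum, Finset.mul_sum]

lemma prod_ite_one (S : Finset ℕ) (P : ℕ → Prop) [DecidablePred P] (a : ℝ) :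
    ∏ k ∈ S, (if P k then a else 1) = a ^ (S.filter P).card := by
  rw [Finset.prod_ite]; simp

open Classical in
lemma plrmin_eq {n : ℕ} (π : Equiv.Perm (Fin n)) : plrmin π =
    ((Finset.Icc 1 n).filter fun k => word π (k+1) < word π k ∧ TT (word π) k).card := by
  have hw := isW_word π
  unfold plrmin
  rw [← Finset.card_image_of_injOn (f := word π), ← Finset.card_image_of_injOn (s := filter (fun k => word π (k+1) < word π k ∧ TT (word π) k) _) (f := fun k => word π k + 1)]
  · congr 1
    ext v
    simp only [Finset.mem_image, Finset.mem_filter, Finset.mem_Icc]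
    constructor
    · rintro ⟨i, ⟨hi, hL, h1, k, hk, hik, hwk, hd⟩, rfl⟩
      have := hw.pos i hi.1 hi.2
      exact ⟨k, ⟨hk, hd, i, hi.1, hik, fun j h1 h2 => hL j ⟨h1, by omega⟩ h2, by omega⟩, by omega⟩
    · rintro ⟨k, ⟨hk, hd, i, hi, hik, hL, he⟩, rfl⟩
      have := hw.pos k hk.1 hk.2
      exact ⟨i, ⟨⟨hi, by omega⟩, fun j h1 h2 => hL j h1.1 h2, by omega, k, hk, hik, by omega, hd⟩, he⟩
  · intro a ha b hb hab
    simp only [Finset.coe_filter, Set.mem_ofPred_eq, Finset.mem_Icc] at ha hb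
    exact hw.inj _ _ ha.1.1 ha.1.2 hb.1.1 hb.1.2 (by simpa using hab)
  · intro a ha b hb hab
    simp only [Finset.coe_filter, Set.mem_ofPred_eq, Finset.mem_Icc] at ha hb
    exact hw.inj _ _ ha.1.1 ha.1.2 hb.1.1 hb.1.2 hab

open Classical in
lemma des_eq {n : ℕ} (π : Equiv.Perm (Fin (n+1))) : des π - plrmin π =
    ((Finset.Icc 1 (n+1)).filter fun k => word π k ≠ n + 1 ∧ word π (k+1) < word π k ∧
      ¬ TT (word π) k).card := by
  have hw := isW_word π
  obtain ⟨m, hm1, hm2, hm⟩ := hw.surj (n+1) (by omega) le_rfl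
  have hd : des π + 1 = ((Finset.Icc 1 (n+1)).filter fun k => word π (k+1) < word π k).card := by
    have : (Finset.Icc 1 (n+1)) = insert (n+1) (Finset.Icc 1 n) := by
      ext; simp only [Finset.mem_insert, Finset.mem_Icc]; omega
    rw [this, Finset.filter_insert, if_pos, Finset.card_insert_of_notMem]
    · rfl
    · simp
    · rw [hw.out (n+1+1) (by omega)]
      exact hw.pos _ (by omega) le_rfl
  have hs : ((Finset.Icc 1 (n+1)).filter fun k => word π (k+1) < word π k) =
     insert m (((Finset.Icc 1 (n+1)).filter fun k => word π (k+1) < word π k ∧ TT (word π) k) ∪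
     ((Finset.Icc 1 (n+1)).filter fun k => word π k ≠ n + 1 ∧ word π (k+1) < word π k ∧
      ¬ TT (word π) k)) := by
    ext k
    simp only [Finset.mem_insert, Finset.mem_filter, Finset.mem_union, Finset.mem_Icc]
    have hmd : word π (m+1) < word π m := by
      by_cases h : m + 1 ≤ n + 1
      · have := hw.le (m+1)
        rcases Nat.lt_or_ge (word π (m+1)) (word π m) with h1 | h1
        · exact h1
        · have := hw.inj (m+1) m (by omega) h hm1 hm2 (by omega)
          omega
      · rw [hw.out _ (by omega)]; omega
    constructor
    · rintro ⟨h1, h2⟩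
      by_cases hk : word π k = n + 1
      · left; exact hw.inj _ _ h1.1 h1.2 hm1 hm2 (by omega)
      · right
        by_cases hT : TT (word π) k
        · left; exact ⟨h1, h2, hT⟩
        · right; exact ⟨h1, hk, h2, hT⟩
    · rintro (rfl | h | h)
      · exact ⟨⟨hm1, hm2⟩, hmd⟩
      · exact ⟨h.1, h.2.1⟩
      · exact ⟨h.1, h.2.2.1⟩
  rw [hs, Finset.card_insert_of_notMem, Finset.card_union_of_disjoint, ← plrmin_eq] at hd
  · omega
  · rw [Finset.disjoint_left]
    intro k h1 h2
    simp only [Finset.mem_filter] at h1 h2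
    exact h2.2.2.2 h1.2.2
  · simp only [Finset.mem_filter, Finset.mem_union, not_or, not_and]
    exact ⟨fun _ _ => not_TT_max hw hm, fun _ h => absurd hm h⟩

open Classical in
lemma lrmin_eq {n : ℕ} (π : Equiv.Perm (Fin (n+1))) : lrmin π - 1 =
    ((Finset.Icc 1 (n+1)).filter fun k => LL (word π) k ∧ word π k ≠ 1).card := by
  have hw := isW_word π
  obtain ⟨m, hm1, hm2, hm⟩ := hw.surj 1 (by omega) (by omega)
  have : ((Finset.Icc 1 (n+1)).filter fun i => ∀ j ∈ Finset.Icc 1 (n+1), j < i → word π i < word π j)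
     = insert m ((Finset.Icc 1 (n+1)).filter fun k => LL (word π) k ∧ word π k ≠ 1) := by
    ext k
    simp only [Finset.mem_insert, Finset.mem_filter, Finset.mem_Icc]
    constructor
    · rintro ⟨h1, h2⟩
      by_cases hk : word π k = 1
      · left; exact hw.inj _ _ h1.1 h1.2 hm1 hm2 (by omega)
      · right; exact ⟨h1, fun j h3 h4 => h2 j ⟨h3, by omega⟩ h4, hk⟩
    · rintro (rfl | ⟨h1, h2, h3⟩)
      · refine ⟨⟨hm1, hm2⟩, fun j hj hjk => ?_⟩
        have := hw.pos j hj.1 hj.2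
        rcases Nat.lt_or_ge (word π k) (word π j) with h1 | h1
        · exact h1
        · have := hw.inj j k hj.1 hj.2 hm1 hm2 (by omega)
          omega
      · exact ⟨h1, fun j h3 h4 => h2 j h3.1 h4⟩
  unfold lrmin
  rw [this, Finset.card_insert_of_notMem]
  · simp
  · simp [hm]

open Classical in
lemma simsuc_eq {n : ℕ} (π : Equiv.Perm (Fin n)) : simsuc π =
    ((Finset.Icc 1 n).filter fun k => QQ n (word π) k).card := by
  unfold simsuc
  congr 1
  ext i
  simp only [Finset.mem_filter, Finset.mem_Icc]
  apply and_congr_right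
  intro hi
  unfold QQ
  constructor
  · rintro ⟨j, hj, hij, he, h⟩
    exact ⟨j, hj.2, hij, he, fun k h1 h2 => h k ⟨by omega, by omega⟩ h1 h2⟩
  · rintro ⟨j, hj, hij, he, h⟩
    exact ⟨j, ⟨by omega, hj⟩, hij, he, fun k _ h1 h2 => h k h1 h2⟩

lemma basc_eq {n : ℕ} (π : Equiv.Perm (Fin (n+1))) : basc π =
    ((Finset.Icc 1 (n+1)).filter fun k => word π k + 2 ≤ word π (k+1)).card := by
  have hw := isW_word π
  have : (Finset.Icc 1 (n+1)) = insert (n+1) (Finset.Icc 1 n) := by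
    ext; simp only [Finset.mem_insert, Finset.mem_Icc]; omega
  rw [this, Finset.filter_insert, if_neg]
  · rfl
  · rw [hw.out (n+1+1) (by omega)]; omega

lemma suc_eq {n : ℕ} (π : Equiv.Perm (Fin (n+1))) : suc π =
    ((Finset.Icc 1 (n+1)).filter fun k => word π (k+1) = word π k + 1).card := by
  have hw := isW_word π
  have : (Finset.Icc 1 (n+1)) = insert (n+1) (Finset.Icc 1 n) := by
    ext; simp only [Finset.mem_insert, Finset.mem_Icc]; omega
  rw [this, Finset.filter_insert, if_neg]
  · rfl
  · rw [hw.out (n+1+1) (by omega)]; omega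

open Classical in
lemma wt_eq {n : ℕ} (π : Equiv.Perm (Fin (n+1))) (x y s t p q : ℝ) :
    x ^ basc π * y ^ (des π - plrmin π) * s ^ suc π * t ^ plrmin π *
          p ^ (lrmin π - 1) * q ^ simsuc π = wt x y s t p q (n+1) (word π) := by
  have hw := isW_word π
  rw [des_eq, plrmin_eq, lrmin_eq, simsuc_eq, basc_eq, suc_eq]
  unfold wt gam
  rw [Finset.prod_mul_distrib, prod_ite_one, prod_ite_one, ← mul_assoc]
  congr 2
  have h0 : ∀ a : ℝ, ∀ P Q : ℕ → Prop, ∀ hP : DecidablePred P, (∀ k, P k ↔ Q k) →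
      a ^ ((Finset.Icc 1 (n+1)).filter P).card = ∏ k ∈ Finset.Icc 1 (n+1), if Q k then a else 1 := by
    intro a P Q hP h
    rw [prod_ite_one]
    congr 2
    ext k; simp [h]
  rw [h0 x _ _ _ fun k => Iff.rfl, h0 y _ _ _ fun k => Iff.rfl, h0 s _ _ _ fun k => Iff.rfl,
    h0 t _ _ _ fun k => Iff.rfl]
  simp only [← Finset.prod_mul_distrib]
  apply Finset.prod_congr rfl
  intro k hk
  simp only [Finset.mem_Icc] at hk
  have h1 := hw.le (k+1)
  have hne : word π (k+1) ≠ word π k := by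
    have := hw.pos k hk.1 hk.2
    by_cases h : k + 1 ≤ n + 1
    · intro he
      have := hw.inj _ _ (by omega) h hk.1 hk.2 he
      omega
    · rw [hw.out (k+1) (by omega)]; omega
  have hT : word π k = n + 1 → ¬ TT (word π) k := not_TT_max hw
  unfold tau
  by_cases hT' : TT (word π) k
  · have : word π k ≠ n + 1 := fun h => hT h hT'
    simp only [hT', not_true, and_false, and_true, if_false, if_true]
    split_ifs <;> first | omega | simp
  · simp only [hT', not_false_iff, and_false, and_true, if_false]
    split_ifs <;> first | omega | simp

/-! ### The cycle side -/

open Equiv Equiv.Perm in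
lemma card_swap_mul_of_ne {α : Type*} [Fintype α] [DecidableEq α] (σ : Equiv.Perm α) (a b : α)
    (ha : σ a = a) (hb : σ b ≠ b) : (swap a b * σ).cycleType.card = σ.cycleType.card := by
  have hbs : b ∈ σ.support := by rwa [mem_support]
  have hc : σ.cycleOf b ∈ σ.cycleFactorsFinset := cycleOf_mem_cycleFactorsFinset_iff.2 hbs
  have hdis := disjoint_mul_inv_of_mem_cycleFactorsFinset hc
  set c := σ.cycleOf b with hcdef
  set r := σ * c⁻¹ with hr
  have hσ : σ = c * r := by
    rw [← hdis.commute.eq, hr]; simp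
  have hcyc : c.IsCycle := (mem_cycleFactorsFinset_iff.1 hc).1
  have hca : c a = a := by
    have : a ∉ c.support := by
      intro h
      have := support_cycleOf_le σ b h
      rw [mem_support] at this
      exact this ha
    simpa using this
  have hra : r a = a := by
    rw [hr, Perm.mul_apply]
    have : c⁻¹ a = a := by rw [Perm.inv_eq_iff_eq]; exact hca.symm
    rw [this, ha]
  have hcb : c b ≠ b := by rw [hcdef, cycleOf_apply_self]; exact hb
  have hrb : r b = b := (hdis b).resolve_right hcb
  have hcyc2 : (swap a b * c).IsCycle := by
    have h1 := formPerm_toList σ b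
    have h2 := two_le_length_toList_iff_mem_support.2 hbs
    have h3 := nodup_toList σ b
    have h4 : ∃ l, toList σ b = b :: l := by
      cases hl : toList σ b with
      | nil => rw [hl] at h2; simp at h2
      | cons z l =>
        refine ⟨l, ?_⟩
        have := getElem_toList (p := σ) (x := b) (n := 0) (by omega)
        simp [hl] at this
        rw [this]
    obtain ⟨l, hl⟩ := h4
    have ha' : a ∉ toList σ b := by
      rw [mem_toList_iff]
      rintro ⟨h, _⟩
      exact hb ((h.apply_eq_self_iff).2 ha)
    rw [hcdef, ← h1, hl, ← List.formPerm_cons_cons]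
    apply List.isCycle_formPerm
    · rw [← hl]; exact List.nodup_cons.2 ⟨ha', h3⟩
    · simp
  have hdis2 : Equiv.Perm.Disjoint (swap a b * c) r := by
    intro z
    rcases hdis z with h | h
    · right; exact h
    · by_cases hza : z = a
      · right; rw [hza]; exact hra
      · by_cases hzb : z = b
        · right; rw [hzb]; exact hrb
        · left; rw [Perm.mul_apply, h, swap_apply_of_ne_of_ne hza hzb]
  rw [hσ, ← mul_assoc, hdis2.cycleType_mul, hdis.symm.cycleType_mul, hcyc2.cycleType, hcyc.cycleType]
  simp

open Equiv Equiv.Perm in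
lemma card_swap_mul_of_eq {α : Type*} [Fintype α] [DecidableEq α] (σ : Equiv.Perm α) (a b : α)
    (ha : σ a = a) (hb : σ b = b) (hab : a ≠ b) :
    (swap a b * σ).cycleType.card = σ.cycleType.card + 1 := by
  have hdis : Equiv.Perm.Disjoint (swap a b) σ := by
    intro z
    by_cases hza : z = a
    · right; rw [hza]; exact ha
    · by_cases hzb : z = b
      · right; rw [hzb]; exact hb
      · left; rw [swap_apply_of_ne_of_ne hza hzb]
  rw [hdis.cycleType_mul, (isCycle_swap hab).cycleType]
  simp [add_comm]

open Equiv Equiv.Perm in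
lemma cycleType_lift {n : ℕ} (e : Equiv.Perm (Fin n)) :
    (decomposeFin.symm (0, e)).cycleType = e.cycleType := by
  rw [← cycleType_extendDomain (finSuccAboveEquiv (0 : Fin (n+1))) (g := e)]
  congr 1
  ext z
  congr 1
  refine Fin.cases ?_ (fun k => ?_) z
  · rw [decomposeFin_symm_apply_zero, extendDomain_apply_not_subtype]
    simp
  · have := extendDomain_apply_image e (finSuccAboveEquiv (0 : Fin (n+1))) k
    have hf : ∀ j : Fin n, ((finSuccAboveEquiv (0 : Fin (n+1)) j : {x : Fin (n+1) // x ≠ 0}) : Fin (n+1)) = j.succ := by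
      intro j; rw [finSuccAboveEquiv_apply]; simp
    rw [hf, hf] at this
    rw [this]; simp

open Equiv Equiv.Perm in
lemma decomp_eq {n : ℕ} (p : Fin (n+1)) (e : Equiv.Perm (Fin n)) :
    decomposeFin.symm (p, e) = swap 0 p * decomposeFin.symm (0, e) := by
  ext z
  congr 1
  refine Fin.cases ?_ (fun k => ?_) z
  · simp
  · simp

open Equiv Equiv.Perm in
lemma card_decomp {n : ℕ} (k : Fin n) (e : Equiv.Perm (Fin n)) :
    (decomposeFin.symm (k.succ, e)).cycleType.card = e.cycleType.card + if e k = k then 1 else 0 := by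
  rw [decomp_eq, ← cycleType_lift e]
  split_ifs with h
  · apply card_swap_mul_of_eq
    · simp
    · simp [h]
    · exact (Fin.succ_ne_zero k).symm
  · apply card_swap_mul_of_ne
    · simp
    · simp [h]

noncomputable def rho (x y f : ℝ) {n : ℕ} (σ : Equiv.Perm (Fin n)) (k : Fin n) : ℝ :=
  if k < σ k then x else if σ k < k then y else f

noncomputable def rwt (x y f c : ℝ) {n : ℕ} (σ : Equiv.Perm (Fin n)) : ℝ :=
  (∏ k, rho x y f σ k) * c ^ σ.cycleType.card

lemma rwt_eq (x y f c : ℝ) {n : ℕ} (σ : Equiv.Perm (Fin n)) :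
    x ^ excStat σ * y ^ dropStat σ * f ^ fixStat σ * c ^ (cyc σ - fixStat σ) = rwt x y f c σ := by
  unfold rwt cyc
  rw [Nat.add_sub_cancel]
  congr 1
  have h0 : ∀ a : ℝ, ∀ P : Fin n → Prop, ∀ hP : DecidablePred P,
      a ^ (Finset.univ.filter P).card = ∏ k, if P k then a else 1 := by
    intro a P hP
    rw [Finset.prod_ite]; simp
  unfold excStat dropStat fixStat
  rw [h0, h0, h0]
  simp only [← Finset.prod_mul_distrib]
  apply Finset.prod_congr rfl
  intro k _
  unfold rho
  rcases lt_trichotomy k (σ k) with h | h | h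
  · simp [h, h.not_gt, h.ne']
  · simp [← h]
  · simp [h, h.not_gt, h.ne]

lemma rho_deriv (x y f c : ℝ) {n : ℕ} (σ : Equiv.Perm (Fin n)) (k : Fin n) :
    HasDerivAt (fun h => rho (x+h) (y+h) (f+c*h) σ k) (if σ k = k then c else 1) 0 := by
  unfold rho
  rcases lt_trichotomy k (σ k) with h | h | h
  · simp only [h, h.ne', if_true, if_false]
    exact (hasDerivAt_id _).const_add _
  · simp only [← h, lt_irrefl, if_true, if_false]
    simpa using ((hasDerivAt_id (0:ℝ)).const_mul c).const_add f
  · simp only [h, h.not_gt, h.ne, if_true, if_false]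
    exact (hasDerivAt_id _).const_add _

open Equiv Equiv.Perm in
lemma rwt_zero (x y f c : ℝ) {n : ℕ} (σ : Equiv.Perm (Fin n)) :
    rwt x y f c (decomposeFin.symm (0, σ)) = f * rwt x y f c σ := by
  unfold rwt
  rw [cycleType_lift, Fin.prod_univ_succ, mul_assoc]
  have h1 : rho x y f (decomposeFin.symm (0, σ)) 0 = f := by simp [rho]
  rw [h1]
  congr 2
  apply Finset.prod_congr rfl
  intro k _
  simp [rho]

open Equiv Equiv.Perm in
lemma rwt_succ (x y f c : ℝ) {n : ℕ} (σ : Equiv.Perm (Fin n)) (k : Fin n) :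
    rwt x y f c (decomposeFin.symm ((σ k).succ, σ)) =
      x * y * ((∏ j ∈ Finset.univ.erase k, rho x y f σ j) * (if σ k = k then c else 1)
        * c ^ σ.cycleType.card) := by
  unfold rwt
  rw [card_decomp, Fin.prod_univ_succ, ← Finset.mul_prod_erase _ _ (Finset.mem_univ k)]
  have h1 : rho x y f (decomposeFin.symm ((σ k).succ, σ)) 0 = x := by simp [rho]
  have h2 : rho x y f (decomposeFin.symm ((σ k).succ, σ)) k.succ = y := by simp [rho]
  rw [h1, h2, Finset.prod_congr rfl (g := fun j => rho x y f σ j)]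
  · simp only [EmbeddingLike.apply_eq_iff_eq]
    split_ifs <;> ring
  · intro j hj
    have hj : j ≠ k := by simpa using hj
    have : decomposeFin.symm ((σ k).succ, σ) j.succ = (σ j).succ := by
      rw [decomposeFin_symm_apply_succ, swap_apply_of_ne_of_ne]
      · exact Fin.succ_ne_zero _
      · simpa using hj
    simp [rho, this]

noncomputable def Rsum (n : ℕ) (x y f c : ℝ) : ℝ := ∑ σ : Equiv.Perm (Fin n), rwt x y f c σ

lemma rwt_rec (x y f c : ℝ) {n : ℕ} (σ : Equiv.Perm (Fin n)) :
    ∃ d, HasDerivAt (fun h => rwt (x+h) (y+h) (f+c*h) c σ) d 0 ∧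
      ∑ i : Fin (n+1), rwt x y f c (Equiv.Perm.decomposeFin.symm (i, σ)) =
        f * rwt x y f c σ + x * y * d := by
  have hD := (HasDerivAt.fun_finsetProd (u := Finset.univ)
    (fun k _ => rho_deriv x y f c σ k)).mul_const (c ^ σ.cycleType.card)
  refine ⟨_, hD, ?_⟩
  simp only [add_zero, mul_zero, smul_eq_mul]
  rw [Fin.sum_univ_succ, rwt_zero, ← Equiv.sum_comp σ, Finset.sum_mul, Finset.mul_sum]
  simp only [rwt_succ]

lemma Rsum_rec (n : ℕ) (x y f c : ℝ) :
    ∃ d, HasDerivAt (fun h => Rsum n (x+h) (y+h) (f+c*h) c) d 0 ∧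
      Rsum (n+1) x y f c = f * Rsum n x y f c + x * y * d := by
  choose d hd1 hd2 using fun σ : Equiv.Perm (Fin n) => rwt_rec x y f c σ
  refine ⟨∑ π, d π, HasDerivAt.fun_sum fun π _ => hd1 π, ?_⟩
  unfold Rsum
  rw [← Equiv.sum_comp Equiv.Perm.decomposeFin.symm, Fintype.sum_prod_type_right]
  simp only [hd2]
  rw [Finset.sum_add_distrib, Finset.mul_sum, Finset.mul_sum]

lemma main_eq (n : ℕ) (p q : ℝ) : ∀ x y s t : ℝ,
    Lsum (n+1) x y s t p q = Rsum n x y (p*t+q*s) (p+q) := by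
  induction n with
  | zero =>
    intro x y s t
    change Lsum 1 x y s t p q = _
    have h1 : word (1 : Equiv.Perm (Fin 1)) 1 = 1 := by decide
    have h4 : ¬ QQ 1 (word (1 : Equiv.Perm (Fin 1))) 1 := by
      rintro ⟨a, h, h', _⟩; omega
    unfold Lsum Rsum
    rw [Fintype.sum_subsingleton _ (1 : Equiv.Perm (Fin 1)),
      Fintype.sum_subsingleton _ (1 : Equiv.Perm (Fin 0))]
    simp [wt, rwt, tau, gam, h1, h4]
  | succ n ih =>
    intro x y s t
    obtain ⟨d, hd1, hd2⟩ := Lsum_rec (n+1) (by omega) x y s t p q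
    obtain ⟨d', hd1', hd2'⟩ := Rsum_rec n x y (p*t+q*s) (p+q)
    rw [hd2, hd2', ih]
    congr 2
    apply hd1.unique
    have hfun : (fun h => Lsum (n + 1) (x + h) (y + h) (s + h) (t + h) p q) =
        fun h => Rsum n (x + h) (y + h) (p * t + q * s + (p + q) * h) (p + q) := by
      funext h
      rw [ih]
      congr 1
      ring
    rw [hfun]
    exact hd1'

/-- `Σ_{π ∈ S_{n+1}} x^basc y^(des-plrmin) s^suc t^plrmin p^(lrmin-1)
q^simsuc = Σ_{σ ∈ S_n} x^exc y^drop (p t + q s)^fix (p+q)^(cyc-fix)`. -/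
theorem statement18 (n : ℕ) (x y s t p q : ℝ) :
    ∑ π : Equiv.Perm (Fin (n + 1)),
        x ^ basc π * y ^ (des π - plrmin π) * s ^ suc π * t ^ plrmin π *
          p ^ (lrmin π - 1) * q ^ simsuc π =
      ∑ σ : Equiv.Perm (Fin n),
        x ^ excStat σ * y ^ dropStat σ * (p * t + q * s) ^ fixStat σ *
          (p + q) ^ (cyc σ - fixStat σ) := by
  simp only [wt_eq, rwt_eq]
  exact main_eq n p q x y s t

end SucEuler
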